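/- arXiv:2501.12066 — 5 statements merged into one kernel-verified Lean document; each statement's English description precedes it below -/
import Mathlib

section
/- Let K : ℤ → ℝ be even and absolutely summable with spectrum S(f) = Σ_{m∈ℤ} K(m) e^{−2πi f m} satisfying S(f) > 0 for all f ∈ [0,1]. For each n ∈ ℕ let α_1^{(n)}, …, α_n^{(n)} be the eigenvalues of the n×n symmetric Toeplitz matrix Λ^{(n)} with entries Λ^{(n)}_{ij} = K(i−j). Then for every function F : ℝ → ℝ continuous on (0, ∞), (1/n) Σ_{k=1}^{n} F(α_k^{(n)}) → ∫₀¹ F(S(f)) df as n → ∞. -/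
open MeasureTheory Filter Matrix

/-- The spectrum `S(f) = Σ_{m ∈ ℤ} K(m) e^{-2πi f m}` of an even, absolutely summable
auto-covariance function `K : ℤ → ℝ`; by evenness it equals the real cosine series. -/
noncomputable def spectrum' (K : ℤ → ℝ) (f : ℝ) : ℝ :=
  ∑' m : ℤ, K m * Real.cos (2 * Real.pi * f * (m : ℝ))

/-- The `n × n` symmetric Toeplitz matrix with entries `K(i - j)`. -/
def toeplitz (K : ℤ → ℝ) (n : ℕ) : Matrix (Fin n) (Fin n) ℝ :=
  fun i j => K ((i : ℤ) - (j : ℤ))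

/-- The squared modulus of the trigonometric polynomial with real coefficients `u`. -/
noncomputable def trigPower {n : ℕ} (u : Fin n → ℝ) (f : ℝ) : ℝ :=
  ∑ i, ∑ j, u i * u j * Real.cos (2 * Real.pi * f * (((i : ℤ) - (j : ℤ) : ℤ) : ℝ))

lemma continuous_trigPower {n : ℕ} (u : Fin n → ℝ) : Continuous (trigPower u) := by
  unfold trigPower; fun_prop

lemma trigPower_nonneg {n : ℕ} (u : Fin n → ℝ) (f : ℝ) : 0 ≤ trigPower u f := by
  have h : trigPower u f = (∑ i, u i * Real.cos (2 * Real.pi * f * ((i : ℤ) : ℝ))) ^ 2 +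
      (∑ i, u i * Real.sin (2 * Real.pi * f * ((i : ℤ) : ℝ))) ^ 2 := by
    simp only [trigPower, sq, Finset.sum_mul_sum, ← Finset.sum_add_distrib, Int.cast_sub, mul_sub,
      Real.cos_sub]
    refine Finset.sum_congr rfl fun i _ => Finset.sum_congr rfl fun j _ => by ring
  rw [h]
  positivity

lemma integral_cos_two_pi_mul_int (m : ℤ) :
    ∫ f in (0 : ℝ)..1, Real.cos (2 * Real.pi * f * (m : ℝ)) = if m = 0 then 1 else 0 := by
  split_ifs with h
  · simp [h]
  · have hc : (2 * Real.pi * (m : ℝ)) ≠ 0 := by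
      have := Real.pi_ne_zero
      have : (m : ℝ) ≠ 0 := by exact_mod_cast h
      positivity
    have h1 : ∀ f : ℝ, 2 * Real.pi * f * (m : ℝ) = (2 * Real.pi * m) * f := fun f => by ring
    simp_rw [h1]
    rw [intervalIntegral.integral_comp_mul_left _ hc, integral_cos]
    have h2 : Real.sin (2 * Real.pi * m * 1) = 0 := by
      have := Real.sin_int_mul_pi (2 * m)
      push_cast at this
      rw [← this]; ring_nf
    rw [h2]; simp

lemma integral_cos_mul_cos_two_pi_mul_int (m j : ℤ) :
    ∫ f in (0 : ℝ)..1, Real.cos (2 * Real.pi * f * (m : ℝ)) * Real.cos (2 * Real.pi * f * (j : ℝ)) =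
      ((if m = j then 1 else 0) + (if m = -j then 1 else 0)) / 2 := by
  have h : ∀ f : ℝ, Real.cos (2 * Real.pi * f * (m : ℝ)) * Real.cos (2 * Real.pi * f * (j : ℝ)) =
      (Real.cos (2 * Real.pi * f * ((m - j : ℤ) : ℝ)) +
        Real.cos (2 * Real.pi * f * ((m + j : ℤ) : ℝ))) / 2 := fun f => by
    push_cast
    rw [mul_sub, mul_add, Real.cos_sub, Real.cos_add]; ring
  simp_rw [h]
  rw [intervalIntegral.integral_div, intervalIntegral.integral_add
    (Continuous.intervalIntegrable (by fun_prop) _ _)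
    (Continuous.intervalIntegrable (by fun_prop) _ _),
    integral_cos_two_pi_mul_int, integral_cos_two_pi_mul_int]
  simp only [sub_eq_zero, add_eq_zero_iff_eq_neg]

lemma integral_trigPower {n : ℕ} (u : Fin n → ℝ) :
    ∫ f in (0 : ℝ)..1, trigPower u f = ∑ i, u i ^ 2 := by
  unfold trigPower
  rw [intervalIntegral.integral_finsetSum
    fun i _ => Continuous.intervalIntegrable (by fun_prop) _ _]
  refine Finset.sum_congr rfl fun i _ => ?_
  rw [intervalIntegral.integral_finsetSum
    fun i _ => Continuous.intervalIntegrable (by fun_prop) _ _]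
  simp_rw [intervalIntegral.integral_const_mul, integral_cos_two_pi_mul_int, sub_eq_zero,
    Nat.cast_inj, Fin.val_inj]
  simp [sq]

lemma spectrum'_fract (K : ℤ → ℝ) (f : ℝ) : spectrum' K (Int.fract f) = spectrum' K f := by
  refine tsum_congr fun m => ?_
  have h : 2 * Real.pi * Int.fract f * (m : ℝ) =
      2 * Real.pi * f * m - ((⌊f⌋ * m : ℤ) : ℝ) * (2 * Real.pi) := by
    rw [Int.fract]; push_cast; ring
  rw [h, Real.cos_sub_int_mul_two_pi]

lemma norm_mul_cos_le (x y : ℝ) : ‖x * Real.cos y‖ ≤ |x| := by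
  rw [norm_mul, Real.norm_eq_abs, Real.norm_eq_abs]
  exact mul_le_of_le_one_right (abs_nonneg _) (Real.abs_cos_le_one _)

lemma continuous_spectrum' {K : ℤ → ℝ} (hK : Summable fun m : ℤ => |K m|) :
    Continuous (spectrum' K) :=
  continuous_tsum (fun m => by fun_prop) hK fun m f => norm_mul_cos_le _ _

lemma hasSum_integral_spectrum'_mul {K : ℤ → ℝ} (hK : Summable fun m : ℤ => |K m|)
    {g : ℝ → ℝ} (hg : Continuous g) :
    HasSum (fun m : ℤ => K m * ∫ f in (0 : ℝ)..1, Real.cos (2 * Real.pi * f * (m : ℝ)) * g f)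
      (∫ f in (0 : ℝ)..1, spectrum' K f * g f) := by
  have h := intervalIntegral.hasSum_integral_of_dominated_convergence (μ := volume)
    (a := 0) (b := 1) (F := fun (m : ℤ) f => K m * Real.cos (2 * Real.pi * f * (m : ℝ)) * g f)
    (f := fun f => spectrum' K f * g f) (fun m f => |K m| * |g f|)
    (fun m => Continuous.aestronglyMeasurable (by fun_prop))
    (fun m => ae_of_all _ fun f _ => by
      rw [norm_mul]; exact mul_le_mul_of_nonneg_right (norm_mul_cos_le _ _) (abs_nonneg _))
    (ae_of_all _ fun f _ => hK.mul_right _)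
    (Continuous.intervalIntegrable (by simp_rw [tsum_mul_right]; fun_prop) _ _)
    (ae_of_all _ fun f _ => HasSum.mul_right _ <| Summable.hasSum <|
      Summable.of_norm_bounded hK fun m => norm_mul_cos_le _ _)
  simpa only [mul_assoc, intervalIntegral.integral_const_mul] using h

lemma integral_spectrum'_mul_cos {K : ℤ → ℝ} (hK_even : ∀ m, K (-m) = K m)
    (hK : Summable fun m : ℤ => |K m|) (j : ℤ) :
    ∫ f in (0 : ℝ)..1, spectrum' K f * Real.cos (2 * Real.pi * f * (j : ℝ)) = K j := by
  refine (hasSum_integral_spectrum'_mul hK (by fun_prop)).unique ?_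
  simp_rw [integral_cos_mul_cos_two_pi_mul_int]
  have h := ((hasSum_ite_eq j (K j)).add (hasSum_ite_eq (-j) (K j))).div_const 2
  rw [add_self_div_two] at h
  have e : ∀ m, K m * (((if m = j then 1 else 0) + (if m = -j then 1 else 0)) / 2) =
      ((if m = j then K j else 0) + (if m = -j then K j else 0)) / 2 := fun m => by
    have h1 : (if m = j then K j else 0) = K m * if m = j then 1 else 0 := by
      split_ifs <;> simp_all
    have h2 : (if m = -j then K j else 0) = K m * if m = -j then 1 else 0 := by
      split_ifs <;> simp_all
    rw [h1, h2]
    ring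
  simpa only [e] using h

lemma hasSum_sq_integral_spectrum'_mul_self {K : ℤ → ℝ} (hK_even : ∀ m, K (-m) = K m)
    (hK : Summable fun m : ℤ => |K m|) :
    HasSum (fun m => K m ^ 2) (∫ f in (0 : ℝ)..1, spectrum' K f * spectrum' K f) := by
  have h := hasSum_integral_spectrum'_mul hK (continuous_spectrum' hK)
  simp_rw [mul_comm (Real.cos _), integral_spectrum'_mul_cos hK_even hK] at h
  simpa only [sq] using h

lemma integral_spectrum'_mul_trigPower {K : ℤ → ℝ} (hK_even : ∀ m, K (-m) = K m)
    (hK : Summable fun m : ℤ => |K m|) {n : ℕ} (u : Fin n → ℝ) :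
    ∫ f in (0 : ℝ)..1, spectrum' K f * trigPower u f = u ⬝ᵥ (toeplitz K n *ᵥ u) := by
  have hc := continuous_spectrum' hK
  simp only [trigPower, Finset.mul_sum, dotProduct, mulVec, toeplitz]
  rw [intervalIntegral.integral_finsetSum
    fun i _ => Continuous.intervalIntegrable (by fun_prop) _ _]
  refine Finset.sum_congr rfl fun i _ => ?_
  rw [intervalIntegral.integral_finsetSum
    fun i _ => Continuous.intervalIntegrable (by fun_prop) _ _]
  refine Finset.sum_congr rfl fun j _ => ?_
  simp_rw [mul_left_comm (spectrum' K _)]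
  rw [intervalIntegral.integral_const_mul, integral_spectrum'_mul_cos hK_even hK]
  ring

lemma sum_sq_eigenvectorBasis {n : ℕ} {A : Matrix (Fin n) (Fin n) ℝ} (hA : A.IsHermitian)
    (k : Fin n) : ∑ i, hA.eigenvectorBasis k i ^ 2 = 1 := by
  rw [← EuclideanSpace.real_norm_sq_eq, hA.eigenvectorBasis.norm_eq_one, one_pow]

lemma sum_eigenvectorBasis_mul {n : ℕ} {A : Matrix (Fin n) (Fin n) ℝ} (hA : A.IsHermitian)
    (i j : Fin n) :
    ∑ k, hA.eigenvectorBasis k i * hA.eigenvectorBasis k j = if i = j then 1 else 0 := by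
  have h := congr_fun₂ (Unitary.coe_mul_star_self hA.eigenvectorUnitary) i j
  simpa [Matrix.mul_apply, Matrix.one_apply, Matrix.star_apply] using h

lemma integral_trigPower_eigenvector {n : ℕ} {A : Matrix (Fin n) (Fin n) ℝ} (hA : A.IsHermitian)
    (k : Fin n) : ∫ f in (0 : ℝ)..1, trigPower (fun i => hA.eigenvectorBasis k i) f = 1 := by
  rw [integral_trigPower, sum_sq_eigenvectorBasis]

lemma sum_trigPower_eigenvector {n : ℕ} {A : Matrix (Fin n) (Fin n) ℝ} (hA : A.IsHermitian)
    (f : ℝ) : ∑ k, trigPower (fun i => hA.eigenvectorBasis k i) f = n := by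
  unfold trigPower
  rw [Finset.sum_comm]
  have h : ∀ i : Fin n, ∑ k, ∑ j, hA.eigenvectorBasis k i * hA.eigenvectorBasis k j *
      Real.cos (2 * Real.pi * f * (((i : ℤ) - (j : ℤ) : ℤ) : ℝ)) = 1 := fun i => by
    rw [Finset.sum_comm]
    simp_rw [← Finset.sum_mul, sum_eigenvectorBasis_mul]
    simp
  rw [Finset.sum_congr rfl fun i _ => h i]
  simp

lemma integral_spectrum'_mul_trigPower_eigenvector {K : ℤ → ℝ} (hK_even : ∀ m, K (-m) = K m)
    (hK : Summable fun m : ℤ => |K m|) {n : ℕ} (hA : (toeplitz K n).IsHermitian) (k : Fin n) :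
    ∫ f in (0 : ℝ)..1, spectrum' K f * trigPower (fun i => hA.eigenvectorBasis k i) f =
      hA.eigenvalues k := by
  rw [integral_spectrum'_mul_trigPower hK_even hK, hA.mulVec_eigenvectorBasis, dotProduct_smul]
  simp only [dotProduct, ← sq, sum_sq_eigenvectorBasis, smul_eq_mul, mul_one]

lemma Matrix.IsHermitian.sum_sq_eigenvalues {n : ℕ} {A : Matrix (Fin n) (Fin n) ℝ}
    (hA : A.IsHermitian) : ∑ k, hA.eigenvalues k ^ 2 = ∑ i, ∑ j, A i j ^ 2 := by
  have h1 : ∀ k, hA.eigenvalues k ^ 2 = ∑ i, (A *ᵥ fun j => hA.eigenvectorBasis k j) i ^ 2 :=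
    fun k => by
      simp_rw [hA.mulVec_eigenvectorBasis, Pi.smul_apply, smul_eq_mul, mul_pow]
      rw [← Finset.mul_sum, sum_sq_eigenvectorBasis, mul_one]
  simp_rw [h1]
  rw [Finset.sum_comm]
  refine Finset.sum_congr rfl fun i _ => ?_
  simp only [mulVec, dotProduct, sq, Finset.sum_mul_sum]
  rw [Finset.sum_comm]
  refine Finset.sum_congr rfl fun j _ => ?_
  rw [Finset.sum_comm]
  have h2 : ∀ l, ∑ k, A i j * hA.eigenvectorBasis k j * (A i l * hA.eigenvectorBasis k l) =
      A i j * A i l * if j = l then 1 else 0 := fun l => by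
    rw [← sum_eigenvectorBasis_mul hA, Finset.mul_sum]
    exact Finset.sum_congr rfl fun k _ => by ring
  simp [h2]

lemma sum_Icc_neg_eq {g : ℤ → ℝ} (hg : ∀ m, g (-m) = g m) (n : ℕ) :
    ∑ m ∈ Finset.Icc (-n : ℤ) n, g m =
      ∑ i : Fin n, g ((i : ℤ) - (n : ℤ)) + (∑ i : Fin n, g ((i : ℤ) - (n : ℤ)) + g 0) := by
  induction n with
  | zero => simp
  | succ n ih =>
    have hIcc : Finset.Icc (-((n + 1 : ℕ) : ℤ)) ((n + 1 : ℕ) : ℤ) =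
        insert (-((n + 1 : ℕ) : ℤ)) (insert ((n + 1 : ℕ) : ℤ) (Finset.Icc (-n : ℤ) n)) := by
      ext m
      simp only [Finset.mem_Icc, Finset.mem_insert]
      omega
    have hFin : ∑ i : Fin (n + 1), g ((i : ℤ) - ((n + 1 : ℕ) : ℤ)) =
        g ((n + 1 : ℕ) : ℤ) + ∑ i : Fin n, g ((i : ℤ) - (n : ℤ)) := by
      rw [Fin.sum_univ_succ]
      simp only [Fin.val_zero, Fin.val_succ, Nat.cast_add, Nat.cast_one, Nat.cast_zero, zero_sub,
        hg, add_sub_add_right_eq_sub]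
    rw [hIcc, Finset.sum_insert (by simp only [Finset.mem_insert, Finset.mem_Icc]; omega),
      Finset.sum_insert (by simp only [Finset.mem_Icc]; omega), ih, hFin, hg]
    ring

lemma sum_sum_eq_sum_sum_Icc {g : ℤ → ℝ} (hg : ∀ m, g (-m) = g m) (n : ℕ) :
    ∑ i : Fin n, ∑ j : Fin n, g ((i : ℤ) - (j : ℤ)) =
      ∑ k ∈ Finset.range n, ∑ m ∈ Finset.Icc (-k : ℤ) k, g m := by
  induction n with
  | zero => simp
  | succ n ih =>
    have hsym : ∀ i : Fin n, g ((n : ℤ) - (i : ℤ)) = g ((i : ℤ) - (n : ℤ)) := fun i => by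
      rw [← hg, neg_sub]
    rw [Finset.sum_range_succ, ← ih, sum_Icc_neg_eq hg]
    simp only [Fin.sum_univ_castSucc, Fin.val_castSucc, Fin.val_last, Finset.sum_add_distrib,
      hsym, sub_self]
    ring

lemma tendsto_sum_sum_div {g : ℤ → ℝ} (hg : ∀ m, g (-m) = g m) {G : ℝ} (hG : HasSum g G) :
    Tendsto (fun n : ℕ => (∑ i : Fin n, ∑ j : Fin n, g ((i : ℤ) - (j : ℤ))) / (n : ℝ))
      atTop (nhds G) := by
  simp_rw [sum_sum_eq_sum_sum_Icc hg, div_eq_inv_mul]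
  exact (hG.comp (Finset.tendsto_Icc_neg (R := ℤ))).cesaro

lemma tendsto_sum_sq_eigenvalues_div {K : ℤ → ℝ} (hK_even : ∀ m, K (-m) = K m)
    (hK : Summable fun m : ℤ => |K m|) (hherm : ∀ n, (toeplitz K n).IsHermitian) :
    Tendsto (fun n : ℕ => (∑ k, (hherm n).eigenvalues k ^ 2) / (n : ℝ)) atTop
      (nhds (∫ f in (0 : ℝ)..1, spectrum' K f * spectrum' K f)) := by
  simp_rw [Matrix.IsHermitian.sum_sq_eigenvalues, toeplitz]
  exact tendsto_sum_sum_div (g := fun m => K m ^ 2) (fun m => by rw [hK_even])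
    (hasSum_sq_integral_spectrum'_mul_self hK_even hK)

lemma exists_abs_sub_le_add_mul_sq {F : ℝ → ℝ} {s : Set ℝ} (hs : IsCompact s)
    (hF : ContinuousOn F s) {ε : ℝ} (hε : 0 < ε) :
    ∃ C, ∀ x ∈ s, ∀ y ∈ s, |F x - F y| ≤ ε + C * (x - y) ^ 2 := by
  obtain ⟨M, hM⟩ := hs.exists_bound_of_continuousOn hF
  obtain ⟨δ, hδ, h⟩ := Metric.uniformContinuousOn_iff.1
    (hs.uniformContinuousOn_of_continuous hF) ε hε
  refine ⟨2 * |M| / δ ^ 2, fun x hx y hy => ?_⟩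
  rcases lt_or_ge (dist x y) δ with hxy | hxy
  · have h1 := (h x hx y hy hxy).le
    rw [Real.dist_eq] at h1
    have : 0 ≤ 2 * |M| / δ ^ 2 * (x - y) ^ 2 := by positivity
    linarith
  · have h1 : |F x - F y| ≤ 2 * |M| := by
      have hx' := hM x hx
      have hy' := hM y hy
      rw [Real.norm_eq_abs] at hx' hy'
      linarith [abs_sub (F x) (F y), le_abs_self M]
    have h2 : δ ^ 2 ≤ (x - y) ^ 2 := by
      rw [← sq_abs (x - y)]
      rw [Real.dist_eq] at hxy
      gcongr
    have h3 : 2 * |M| ≤ 2 * |M| / δ ^ 2 * (x - y) ^ 2 := by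
      rw [div_mul_eq_mul_div, le_div_iff₀ (by positivity)]
      gcongr
    linarith

lemma mem_Icc_of_integral_mul_eq {S p : ℝ → ℝ} (hS : Continuous S) (hp : Continuous p)
    (hp0 : ∀ f, 0 ≤ p f) (hp1 : ∫ f in (0 : ℝ)..1, p f = 1) {α a b : ℝ}
    (hα : ∫ f in (0 : ℝ)..1, S f * p f = α) (hab : ∀ f ∈ Set.Icc (0 : ℝ) 1, S f ∈ Set.Icc a b) :
    α ∈ Set.Icc a b := by
  have hc : ∀ c, ∫ f in (0 : ℝ)..1, c * p f = c := fun c => by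
    rw [intervalIntegral.integral_const_mul, hp1, mul_one]
  rw [← hα]
  constructor
  · rw [← hc a]
    exact intervalIntegral.integral_mono_on zero_le_one
      (Continuous.intervalIntegrable (by fun_prop) _ _)
      (Continuous.intervalIntegrable (by fun_prop) _ _)
      fun f hf => mul_le_mul_of_nonneg_right (hab f hf).1 (hp0 f)
  · rw [← hc b]
    exact intervalIntegral.integral_mono_on zero_le_one
      (Continuous.intervalIntegrable (by fun_prop) _ _)
      (Continuous.intervalIntegrable (by fun_prop) _ _)
      fun f hf => mul_le_mul_of_nonneg_right (hab f hf).2 (hp0 f)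

/-- If `n` probability densities `p k` add up to the constant `n` and `α k` is the mean of `S`
under `p k`, then the empirical law of the `α k` is close to the law of `S` as soon as their second
moments are close. -/
lemma abs_average_sub_integral_le {n : ℕ} (hn : 1 ≤ n) {S F : ℝ → ℝ} (hS : Continuous S)
    (hF : Continuous fun f => F (S f)) {p : Fin n → ℝ → ℝ} (hp : ∀ k, Continuous (p k))
    (hp0 : ∀ k f, 0 ≤ p k f) (hp1 : ∀ k, ∫ f in (0 : ℝ)..1, p k f = 1) {α : Fin n → ℝ}
    (hα : ∀ k, ∫ f in (0 : ℝ)..1, S f * p k f = α k) (hsum : ∀ f, ∑ k, p k f = n) {ε C : ℝ}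
    (h : ∀ k, ∀ f ∈ Set.Icc (0 : ℝ) 1, |F (α k) - F (S f)| ≤ ε + C * (α k - S f) ^ 2) :
    |(∑ k, F (α k)) / n - ∫ f in (0 : ℝ)..1, F (S f)| ≤
      ε + C * ((∫ f in (0 : ℝ)..1, S f * S f) - (∑ k, α k ^ 2) / n) := by
  have hn0 : (0 : ℝ) < n := by exact_mod_cast hn
  have hint : ∀ g : ℝ → ℝ, Continuous g →
      ∑ k, ∫ f in (0 : ℝ)..1, g f * p k f = n * ∫ f in (0 : ℝ)..1, g f := fun g hg => by
    rw [← intervalIntegral.integral_finsetSum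
      fun i _ => Continuous.intervalIntegrable (hg.fun_mul (hp i)) _ _]
    simp_rw [← Finset.mul_sum, hsum]
    rw [intervalIntegral.integral_mul_const, mul_comm]
  have h1 : ∀ k, ∫ f in (0 : ℝ)..1, (F (α k) - F (S f)) * p k f =
      F (α k) - ∫ f in (0 : ℝ)..1, F (S f) * p k f := fun k => by
    simp_rw [sub_mul]
    rw [intervalIntegral.integral_sub ((continuous_const.fun_mul (hp k)).intervalIntegrable _ _)
      ((hF.fun_mul (hp k)).intervalIntegrable _ _), intervalIntegral.integral_const_mul, hp1,
      mul_one]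
  have h2 : ∀ k, ∫ f in (0 : ℝ)..1, (ε + C * (α k - S f) ^ 2) * p k f =
      ε + C * ((∫ f in (0 : ℝ)..1, (S f * S f) * p k f) - α k ^ 2) := fun k => by
    have := hp k
    have e : ∀ f, (ε + C * (α k - S f) ^ 2) * p k f = (ε + C * α k ^ 2) * p k f -
        2 * C * α k * (S f * p k f) + C * (S f * S f * p k f) := fun f => by ring
    simp_rw [e]
    rw [intervalIntegral.integral_add (Continuous.intervalIntegrable (by fun_prop) _ _)
      (Continuous.intervalIntegrable (by fun_prop) _ _),
      intervalIntegral.integral_sub (Continuous.intervalIntegrable (by fun_prop) _ _)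
      (Continuous.intervalIntegrable (by fun_prop) _ _)]
    simp_rw [intervalIntegral.integral_const_mul, hp1, hα]
    ring
  have h3 : ∀ k, |F (α k) - ∫ f in (0 : ℝ)..1, F (S f) * p k f| ≤
      ε + C * ((∫ f in (0 : ℝ)..1, (S f * S f) * p k f) - α k ^ 2) := fun k => by
    have := hp k
    rw [← h1, ← h2]
    refine (intervalIntegral.abs_integral_le_integral_abs zero_le_one).trans
      (intervalIntegral.integral_mono_on zero_le_one
        (((continuous_const.sub hF).mul (hp k)).abs.intervalIntegrable _ _)
        (Continuous.intervalIntegrable (by fun_prop) _ _) fun f hf => ?_)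
    rw [abs_mul, abs_of_nonneg (hp0 k f)]
    exact mul_le_mul_of_nonneg_right (h k f hf) (hp0 k f)
  have h4 : |∑ k, (F (α k) - ∫ f in (0 : ℝ)..1, F (S f) * p k f)| ≤
      ∑ k, (ε + C * ((∫ f in (0 : ℝ)..1, (S f * S f) * p k f) - α k ^ 2)) :=
    (Finset.abs_sum_le_sum_abs _ _).trans (Finset.sum_le_sum fun k _ => h3 k)
  rw [Finset.sum_sub_distrib, hint _ hF, Finset.sum_add_distrib, ← Finset.mul_sum,
    Finset.sum_sub_distrib, hint _ (hS.fun_mul hS)] at h4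
  rw [← mul_le_mul_iff_right₀ hn0]
  calc _ = |∑ k, F (α k) - n * ∫ f in (0 : ℝ)..1, F (S f)| := by
        rw [← abs_of_pos hn0, ← abs_mul, abs_of_pos hn0, mul_sub, mul_div_cancel₀ _ hn0.ne']
    _ ≤ _ := h4
    _ = _ := by simp; field_simp

/-- **Szegő-type theorem for eigenvalues of Toeplitz covariance matrices.** Let `K : ℤ → ℝ` be
even and absolutely summable with everywhere positive spectrum `S` on `[0,1]`, and let
`α_1⁽ⁿ⁾, …, α_n⁽ⁿ⁾` be the eigenvalues of the symmetric Toeplitz matrix `Λ⁽ⁿ⁾` with entries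
`K(i - j)`. Then for every `F` continuous on `(0, ∞)`,
`(1/n) Σ_k F(α_k⁽ⁿ⁾) → ∫₀¹ F(S(f)) df`. -/
theorem toeplitz_eigenvalue_average_tendsto
    (K : ℤ → ℝ) (hK_even : ∀ m, K (-m) = K m)
    (hK_sum : Summable fun m : ℤ => |K m|)
    (hS_pos : ∀ f ∈ Set.Icc (0 : ℝ) 1, 0 < spectrum' K f)
    (hherm : ∀ n, (toeplitz K n).IsHermitian)
    (F : ℝ → ℝ) (hF : ContinuousOn F (Set.Ioi 0)) :
    Tendsto (fun n : ℕ => (∑ k : Fin n, F ((hherm n).eigenvalues k)) / (n : ℝ))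
      atTop (nhds (∫ f in (0 : ℝ)..1, F (spectrum' K f))) := by
  have hSpos : ∀ f, 0 < spectrum' K f := fun f => by
    rw [← spectrum'_fract]
    exact hS_pos _ ⟨Int.fract_nonneg f, (Int.fract_lt_one f).le⟩
  have hSc := continuous_spectrum' hK_sum
  have hFS : Continuous fun f => F (spectrum' K f) := hF.comp_continuous hSc hSpos
  obtain ⟨x₀, -, hx₀⟩ := isCompact_Icc.exists_isMinOn
    (Set.nonempty_Icc.2 (zero_le_one (α := ℝ))) hSc.continuousOn
  obtain ⟨x₁, -, hx₁⟩ := isCompact_Icc.exists_isMaxOn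
    (Set.nonempty_Icc.2 (zero_le_one (α := ℝ))) hSc.continuousOn
  have hS_mem : ∀ f ∈ Set.Icc (0 : ℝ) 1,
      spectrum' K f ∈ Set.Icc (spectrum' K x₀) (spectrum' K x₁) :=
    fun f hf => ⟨hx₀ hf, hx₁ hf⟩
  have hsub : Set.Icc (spectrum' K x₀) (spectrum' K x₁) ⊆ Set.Ioi 0 :=
    fun x hx => (hSpos x₀).trans_le hx.1
  have hα_mem : ∀ n k, (hherm n).eigenvalues k ∈
      Set.Icc (spectrum' K x₀) (spectrum' K x₁) := fun n k =>
    mem_Icc_of_integral_mul_eq hSc (continuous_trigPower _) (trigPower_nonneg _)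
      (integral_trigPower_eigenvector _ k)
      (integral_spectrum'_mul_trigPower_eigenvector hK_even hK_sum _ k) hS_mem
  rw [Metric.tendsto_atTop]
  intro ε hε
  obtain ⟨C, hC⟩ := exists_abs_sub_le_add_mul_sq isCompact_Icc (hF.mono hsub) (half_pos hε)
  have hlim : Tendsto (fun n : ℕ => C * ((∫ f in (0 : ℝ)..1, spectrum' K f * spectrum' K f) -
      (∑ k, (hherm n).eigenvalues k ^ 2) / n)) atTop (nhds 0) := by
    have h := (tendsto_sum_sq_eigenvalues_div hK_even hK_sum hherm).const_sub
      (∫ f in (0 : ℝ)..1, spectrum' K f * spectrum' K f)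
    simpa using h.const_mul C
  obtain ⟨N, hN⟩ := eventually_atTop.1
    ((hlim.eventually_lt_const (half_pos hε)).and (eventually_ge_atTop 1))
  refine ⟨N, fun n hn => ?_⟩
  obtain ⟨hn1, hn2⟩ := hN n hn
  have key := abs_average_sub_integral_le hn2 hSc hFS (fun k => continuous_trigPower
      (fun i => (hherm n).eigenvectorBasis k i))
    (fun k => trigPower_nonneg _) (fun k => integral_trigPower_eigenvector _ k)
    (fun k => integral_spectrum'_mul_trigPower_eigenvector hK_even hK_sum _ k)
    (sum_trigPower_eigenvector (hherm n))
    (fun k f hf => hC _ (hα_mem n k) _ (hS_mem f hf))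
  rw [Real.dist_eq]
  linarith
end

section
/- Let K : ℤ → ℝ be even and absolutely summable with spectrum S(f) = Σ_{m∈ℤ} K(m) e^{−2πi f m}, and for n ∈ ℕ and 0 ≤ k ≤ n−1 define the truncated Fourier sums β_k^{(n)} = Σ_{m = −⌊n/2⌋}^{⌊n/2⌋} K(m) e^{−2πi k m / n} (real numbers, since K is even). Then for every continuous function g : ℝ → ℝ, (1/n) Σ_{k=0}^{n−1} g(β_k^{(n)}) → ∫₀¹ g(S(f)) df as n → ∞. -/
open MeasureTheory Filter

/-- The truncated Fourier sum `β_k⁽ⁿ⁾ = Σ_{m = -⌊n/2⌋}^{⌊n/2⌋} K(m) e^{-2πi k m / n}`,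
real-valued since `K` is even. These are the eigenvalues of the circulant approximation to
the Toeplitz covariance matrix. -/
noncomputable def circEig (K : ℤ → ℝ) (n : ℕ) (k : ℕ) : ℝ :=
  ∑ m ∈ Finset.Icc (-((n / 2 : ℕ) : ℤ)) ((n / 2 : ℕ) : ℤ),
    K m * Real.cos (2 * Real.pi * (k : ℝ) * (m : ℝ) / (n : ℝ))

theorem circEig_eq_tsum (K : ℤ → ℝ) (n k : ℕ) :
    circEig K n k = ∑' m : ℤ,
      if m ∈ Finset.Icc (-((n / 2 : ℕ) : ℤ)) ((n / 2 : ℕ) : ℤ) then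
        K m * Real.cos (2 * Real.pi * (k : ℝ) * (m : ℝ) / (n : ℝ)) else 0 := by
  rw [circEig, tsum_eq_sum
    (s := Finset.Icc (-((n / 2 : ℕ) : ℤ)) ((n / 2 : ℕ) : ℤ)) fun m hm => if_neg hm]
  exact Finset.sum_congr rfl fun m hm => (if_pos hm).symm

theorem abs_circEig_le (K : ℤ → ℝ) (hK_sum : Summable fun m : ℤ => |K m|) (n k : ℕ) :
    |circEig K n k| ≤ ∑' m : ℤ, |K m| := by
  refine (Finset.abs_sum_le_sum_abs _ _).trans
    ((Finset.sum_le_sum fun m _ => ?_).trans (hK_sum.sum_le_tsum _ fun m _ => abs_nonneg _))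
  rw [abs_mul]
  exact mul_le_of_le_one_right (abs_nonneg _) (Real.abs_cos_le_one _)

/-- If `k n / n → f`, the circulant eigenvalue with index `k n` tends to the spectrum at `f`. -/
theorem tendsto_circEig (K : ℤ → ℝ) (hK_sum : Summable fun m : ℤ => |K m|) {k : ℕ → ℕ} {f : ℝ}
    (hk : Tendsto (fun n : ℕ => (k n : ℝ) / n) atTop (nhds f)) :
    Tendsto (fun n : ℕ => circEig K n (k n)) atTop (nhds (spectrum' K f)) := by
  simp_rw [circEig_eq_tsum]
  refine tendsto_tsum_of_dominated_convergence hK_sum (fun m => ?_)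
    (Eventually.of_forall fun n m => ?_)
  · have hcos : Tendsto (fun n : ℕ => K m * Real.cos (2 * Real.pi * ((k n : ℝ) / n) * (m : ℝ)))
        atTop (nhds (K m * Real.cos (2 * Real.pi * f * (m : ℝ)))) :=
      ((Real.continuous_cos.tendsto _).comp ((hk.const_mul _).mul_const _)).const_mul _
    refine hcos.congr' ?_
    filter_upwards [eventually_ge_atTop (2 * m.natAbs)] with n hn
    rw [if_pos (Finset.mem_Icc.2 (by omega))]
    congr 2
    ring
  · split_ifs
    · rw [Real.norm_eq_abs, abs_mul]
      exact mul_le_of_le_one_right (abs_nonneg _) (Real.abs_cos_le_one _)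
    · simp

theorem integral_comp_natFloor_eq_sum (u : ℕ → ℝ) (n : ℕ) :
    ∫ x in (0 : ℝ)..n, u ⌊x⌋₊ = ∑ k ∈ Finset.range n, u k := by
  have heq (k : ℕ) : Set.EqOn (fun _ => u k) (fun x : ℝ => u ⌊x⌋₊)
      (Set.Ioo (k : ℝ) ((k + 1 : ℕ) : ℝ)) := by
    intro x hx
    have hfloor : ⌊x⌋₊ = k :=
      (Nat.floor_eq_iff ((Nat.cast_nonneg k).trans hx.1.le)).2 ⟨hx.1.le, by exact_mod_cast hx.2⟩
    simp [hfloor]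
  have hle (k : ℕ) : (k : ℝ) ≤ ((k + 1 : ℕ) : ℝ) := by simp
  have hint (k : ℕ) : IntervalIntegrable (fun x : ℝ => u ⌊x⌋₊) volume k ((k + 1 : ℕ) : ℝ) := by
    rw [intervalIntegrable_iff_integrableOn_Ioo_of_le (hle k)]
    exact (integrableOn_const (by simp)).congr_fun (heq k) measurableSet_Ioo
  have hadj := intervalIntegral.sum_integral_adjacent_intervals (n := n)
    (a := fun k : ℕ => (k : ℝ)) fun k _ => hint k
  rw [Nat.cast_zero] at hadj
  rw [← hadj]
  refine Finset.sum_congr rfl fun k _ => ?_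
  rw [intervalIntegral.integral_of_le (hle k), integral_Ioc_eq_integral_Ioo,
    ← setIntegral_congr_fun measurableSet_Ioo (heq k)]
  simp

theorem integral_comp_natFloor_mul_eq_average (u : ℕ → ℝ) {n : ℕ} (hn : n ≠ 0) :
    ∫ x in (0 : ℝ)..1, u ⌊x * n⌋₊ = (∑ k ∈ Finset.range n, u k) / (n : ℝ) := by
  rw [intervalIntegral.integral_comp_mul_right (fun x : ℝ => u ⌊x⌋₊) (Nat.cast_ne_zero.2 hn),
    zero_mul, one_mul, integral_comp_natFloor_eq_sum, smul_eq_mul, inv_mul_eq_div]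

/-- **Averages of continuous functions of the circulant eigenvalues.** Let `K : ℤ → ℝ` be even
and absolutely summable with spectrum `S`. Then for every continuous `g : ℝ → ℝ`,
`(1/n) Σ_{k=0}^{n-1} g(β_k⁽ⁿ⁾) → ∫₀¹ g(S(f)) df`. -/
theorem circulant_eigenvalue_average_tendsto
    (K : ℤ → ℝ) (hK_even : ∀ m, K (-m) = K m)
    (hK_sum : Summable fun m : ℤ => |K m|)
    (g : ℝ → ℝ) (hg : Continuous g) :
    Tendsto (fun n : ℕ => (∑ k ∈ Finset.range n, g (circEig K n k)) / (n : ℝ))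
      atTop (nhds (∫ f in (0 : ℝ)..1, g (spectrum' K f))) := by
  obtain ⟨C, hC⟩ := (isCompact_Icc (a := -∑' m : ℤ, |K m|)
    (b := ∑' m : ℤ, |K m|)).exists_bound_of_continuousOn hg.continuousOn
  have hlim : Tendsto (fun n : ℕ => ∫ x in (0 : ℝ)..1, g (circEig K n ⌊x * n⌋₊)) atTop
      (nhds (∫ f in (0 : ℝ)..1, g (spectrum' K f))) := by
    refine intervalIntegral.tendsto_integral_filter_of_dominated_convergence (fun _ => C)
      (Eventually.of_forall fun n => ?_) (Eventually.of_forall fun n => ?_) (by simp) ?_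
    · exact ((measurable_from_top (f := fun k : ℕ => g (circEig K n k))).comp
        (Nat.measurable_floor.comp (measurable_id.mul_const (n : ℝ)))).aestronglyMeasurable
    · exact ae_of_all _ fun x _ => hC _ (abs_le.1 (abs_circEig_le K hK_sum _ _))
    · refine ae_of_all _ fun x hx => (hg.tendsto _).comp (tendsto_circEig K hK_sum ?_)
      rw [Set.uIoc_of_le zero_le_one] at hx
      exact (tendsto_nat_floor_mul_div_atTop hx.1.le).comp tendsto_natCast_atTop_atTop
  refine hlim.congr' ?_
  filter_upwards [eventually_ne_atTop 0] with n hn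
  exact integral_comp_natFloor_mul_eq_average (fun k => g (circEig K n k)) hn
end

section
/- Let K : ℤ → ℝ be even and absolutely summable. For n ∈ ℕ let Λ^{(n)} be the n×n symmetric Toeplitz matrix with entries Λ^{(n)}_{ij} = K(i−j), and let Λ̂^{(n)} be its banded truncation, with entries Λ̂^{(n)}_{ij} = K(i−j) if |i−j| ≤ ⌊n/2⌋ and Λ̂^{(n)}_{ij} = 0 otherwise. Then the normalized squared Frobenius norm of the difference vanishes: (1/n) Σ_{i,j} (Λ^{(n)}_{ij} − Λ̂^{(n)}_{ij})² → 0 as n → ∞. Moreover, the ℓ₂ operator norms of Λ^{(n)} and Λ̂^{(n)} are uniformly bounded by 2 Σ_{m=0}^{∞} |K(m)| for all n. -/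
open MeasureTheory Filter Matrix

/-- The banded truncation of the Toeplitz matrix: entries `K(i - j)` when `|i - j| ≤ ⌊n/2⌋`
and `0` otherwise. -/
def toeplitzBanded (K : ℤ → ℝ) (n : ℕ) : Matrix (Fin n) (Fin n) ℝ :=
  fun i j => if |(i : ℤ) - (j : ℤ)| ≤ ((n / 2 : ℕ) : ℤ) then K ((i : ℤ) - (j : ℤ)) else 0

/-- The **Schur test**: a real matrix whose absolute row and column sums are at most `C` has
`ℓ²` operator norm at most `C`. -/
theorem sqrt_sum_mulVec_sq_le {m n : Type*} [Fintype m] [Fintype n] (A : Matrix m n ℝ) {C : ℝ}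
    (hC : 0 ≤ C) (hrow : ∀ i, ∑ j, |A i j| ≤ C) (hcol : ∀ j, ∑ i, |A i j| ≤ C) (x : n → ℝ) :
    Real.sqrt (∑ i, (A *ᵥ x) i ^ 2) ≤ C * Real.sqrt (∑ i, x i ^ 2) := by
  have key : ∑ i, (A *ᵥ x) i ^ 2 ≤ C ^ 2 * ∑ j, x j ^ 2 := by
    calc ∑ i, (A *ᵥ x) i ^ 2
        ≤ ∑ i, C * ∑ j, |A i j| * x j ^ 2 := by
          refine Finset.sum_le_sum fun i _ => ?_
          refine (Finset.sum_sq_le_sum_mul_sum_of_sq_le_mul Finset.univ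
            (f := fun j => |A i j|) (g := fun j => |A i j| * x j ^ 2)
            (fun j _ => abs_nonneg _) (fun j _ => by positivity) fun j _ => ?_).trans ?_
          · rw [mul_pow, ← sq_abs (A i j)]
            exact le_of_eq (by ring)
          · exact mul_le_mul_of_nonneg_right (hrow i)
              (Finset.sum_nonneg fun j _ => by positivity)
      _ = C * ∑ j, (∑ i, |A i j|) * x j ^ 2 := by
          rw [← Finset.mul_sum, Finset.sum_comm]
          simp_rw [Finset.sum_mul]
      _ ≤ C * ∑ j, C * x j ^ 2 := by
          gcongr with j
          exact hcol j
      _ = C ^ 2 * ∑ j, x j ^ 2 := by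
          rw [← Finset.mul_sum]
          ring
  calc Real.sqrt (∑ i, (A *ᵥ x) i ^ 2)
      ≤ Real.sqrt (C ^ 2 * ∑ j, x j ^ 2) := Real.sqrt_le_sqrt key
    _ = C * Real.sqrt (∑ i, x i ^ 2) := by
        rw [Real.sqrt_mul (sq_nonneg C), Real.sqrt_sq hC]

theorem sum_comp_le_tsum_of_injective {ι β : Type*} [Fintype ι] {f : β → ℝ} (hf : Summable f)
    (hf0 : ∀ b, 0 ≤ f b) {e : ι → β} (he : Function.Injective e) :
    ∑ i, f (e i) ≤ ∑' b, f b := by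
  rw [← tsum_fintype (L := .unconditional ι)]
  exact tsum_comp_le_tsum_of_inj hf hf0 he

theorem injective_sub_intCast_fin (a : ℤ) (n : ℕ) :
    Function.Injective fun j : Fin n => a - (j : ℤ) := by
  intro j k h
  ext
  simp only at h
  omega

theorem injective_intCast_fin_sub (a : ℤ) (n : ℕ) :
    Function.Injective fun j : Fin n => (j : ℤ) - a := by
  intro j k h
  ext
  simp only at h
  omega

theorem tsum_int_le_two_mul_tsum_nat {f : ℤ → ℝ} (hf : Summable f) (h0 : 0 ≤ f 0)
    (heven : ∀ m, f (-m) = f m) : ∑' m : ℤ, f m ≤ 2 * ∑' m : ℕ, f m := by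
  have hnat : Summable fun m : ℕ => f m := hf.comp_injective Nat.cast_injective
  have hneg : Summable fun m : ℕ => f (-m) := by simpa only [heven] using hnat
  rw [Summable.tsum_of_nat_of_neg hnat hneg]
  simp only [heven]
  linarith

theorem abs_toeplitzBanded_le (K : ℤ → ℝ) (n : ℕ) (i j : Fin n) :
    |toeplitzBanded K n i j| ≤ |toeplitz K n i j| := by
  unfold toeplitzBanded toeplitz
  split_ifs <;> simp

/-- The tails of a summable family on `ℤ` outside the bands `|m| ≤ ⌊n/2⌋` vanish. -/
theorem tendsto_tsum_outside_band {f : ℤ → ℝ} (hf : Summable f) (hf0 : ∀ m, 0 ≤ f m) :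
    Tendsto (fun n : ℕ => ∑' m : ℤ, if |m| ≤ ((n / 2 : ℕ) : ℤ) then 0 else f m)
      atTop (nhds 0) := by
  suffices h : Tendsto (fun n : ℕ => ∑' m : ℤ, if |m| ≤ ((n / 2 : ℕ) : ℤ) then 0 else f m)
      atTop (nhds (∑' _ : ℤ, (0 : ℝ))) by simpa only [tsum_zero] using h
  refine tendsto_tsum_of_dominated_convergence hf (fun m => ?_) (.of_forall fun n m => ?_)
  · refine tendsto_const_nhds.congr' ?_
    filter_upwards [eventually_ge_atTop (2 * m.natAbs)] with n hn
    rw [if_pos (by rw [Int.abs_eq_natAbs]; omega)]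
  · split_ifs
    · simpa using hf0 m
    · rw [Real.norm_of_nonneg (hf0 m)]

/-- **Asymptotic equivalence of the Toeplitz matrix and its banded truncation.** For `K : ℤ → ℝ`
even and absolutely summable, the normalized squared Frobenius norm (squared weak norm) of
`Λ⁽ⁿ⁾ - Λ̂⁽ⁿ⁾` vanishes as `n → ∞`, and both matrices have ℓ₂ operator norms uniformly bounded
by `2 Σ_{m=0}^∞ |K(m)|`. -/
theorem toeplitz_banded_asymptotically_equivalent
    (K : ℤ → ℝ) (hK_even : ∀ m, K (-m) = K m)
    (hK_sum : Summable fun m : ℤ => |K m|) :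
    Tendsto (fun n : ℕ =>
        (∑ i : Fin n, ∑ j : Fin n, (toeplitz K n i j - toeplitzBanded K n i j) ^ 2) / (n : ℝ))
      atTop (nhds 0) ∧
    (∀ n : ℕ, ∀ x : Fin n → ℝ,
      Real.sqrt (∑ i, ((toeplitz K n) *ᵥ x) i ^ 2)
        ≤ (2 * ∑' m : ℕ, |K (m : ℤ)|) * Real.sqrt (∑ i, x i ^ 2)) ∧
    (∀ n : ℕ, ∀ x : Fin n → ℝ,
      Real.sqrt (∑ i, ((toeplitzBanded K n) *ᵥ x) i ^ 2)
        ≤ (2 * ∑' m : ℕ, |K (m : ℤ)|) * Real.sqrt (∑ i, x i ^ 2)) := by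
  have hC : (0 : ℝ) ≤ 2 * ∑' m : ℕ, |K (m : ℤ)| :=
    mul_nonneg zero_le_two (tsum_nonneg fun _ => abs_nonneg _)
  have hle : ∑' m : ℤ, |K m| ≤ 2 * ∑' m : ℕ, |K (m : ℤ)| :=
    tsum_int_le_two_mul_tsum_nat hK_sum (abs_nonneg _) fun m => by rw [hK_even]
  have hrow (n : ℕ) (i : Fin n) : ∑ j, |toeplitz K n i j| ≤ 2 * ∑' m : ℕ, |K (m : ℤ)| :=
    (sum_comp_le_tsum_of_injective hK_sum (fun _ => abs_nonneg _)
      (injective_sub_intCast_fin i n)).trans hle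
  have hcol (n : ℕ) (j : Fin n) : ∑ i, |toeplitz K n i j| ≤ 2 * ∑' m : ℕ, |K (m : ℤ)| :=
    (sum_comp_le_tsum_of_injective hK_sum (fun _ => abs_nonneg _)
      (injective_intCast_fin_sub j n)).trans hle
  refine ⟨?_, fun n => sqrt_sum_mulVec_sq_le _ hC (hrow n) (hcol n),
    fun n => sqrt_sum_mulVec_sq_le _ hC
      (fun i => (Finset.sum_le_sum fun j _ => abs_toeplitzBanded_le K n i j).trans (hrow n i))
      (fun j => (Finset.sum_le_sum fun i _ => abs_toeplitzBanded_le K n i j).trans (hcol n j))⟩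
  have hsq : Summable fun m : ℤ => K m ^ 2 := by
    refine (hK_sum.mul_left (∑' m, |K m|)).of_nonneg_of_le (fun m => sq_nonneg _) fun m => ?_
    rw [← sq_abs, sq]
    exact mul_le_mul_of_nonneg_right (hK_sum.le_tsum m fun _ _ => abs_nonneg _) (abs_nonneg _)
  refine squeeze_zero (fun n => by positivity) (fun n => ?_)
    (tendsto_tsum_outside_band hsq fun m => sq_nonneg _)
  set g : ℤ → ℝ := fun m => if |m| ≤ ((n / 2 : ℕ) : ℤ) then 0 else K m ^ 2
  have hg0 (m : ℤ) : 0 ≤ g m := by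
    dsimp only [g]
    split_ifs <;> positivity
  have hg : Summable g := hsq.of_nonneg_of_le hg0 fun m => by
    dsimp only [g]
    split_ifs <;> [positivity; rfl]
  refine div_le_of_le_mul₀ n.cast_nonneg (tsum_nonneg hg0) ?_
  calc ∑ i : Fin n, ∑ j : Fin n, (toeplitz K n i j - toeplitzBanded K n i j) ^ 2
      = ∑ i : Fin n, ∑ j : Fin n, g ((i : ℤ) - (j : ℤ)) := by
        refine Finset.sum_congr rfl fun i _ => Finset.sum_congr rfl fun j _ => ?_
        dsimp only [toeplitz, toeplitzBanded, g]
        split_ifs <;> simp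
    _ ≤ ∑ _i : Fin n, ∑' m, g m := Finset.sum_le_sum fun i _ =>
        sum_comp_le_tsum_of_injective hg hg0 (injective_sub_intCast_fin i n)
    _ = (∑' m, g m) * n := by simp [mul_comm]
end

section
/- (Asymptotic normality of the log-likelihood ratio for diagonal Gaussian hypotheses.) For each n let κ_{n,1}, …, κ_{n,n} be positive reals with a ≤ κ_{n,k} ≤ b for all n, k and some 0 < a ≤ b < ∞, set B_n = ( Σ_{k=1}^n (κ_{n,k} − 1)² )^{1/2}, and assume there exists c > 0 with B_n ≥ c√n for all sufficiently large n. Let p^{(n)} = N(0, diag(κ_{n,1}, …, κ_{n,n})) and q^{(n)} = N(0, I_n) on ℝⁿ, with relative entropy D_n = (1/2)( Σ_k κ_{n,k} − Σ_k ln κ_{n,k} − n ) (in nats). If X^{(n)} ∼ p^{(n)}, then the random variables ( ln( (dp^{(n)}/dq^{(n)})(X^{(n)}) ) − D_n ) · √2 / B_n converge in distribution to the standard normal law N(0,1) as n → ∞. -/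
open MeasureTheory Filter Matrix

/-- The density of the centered multivariate Gaussian `N(0, Λ)` on `ℝⁿ`. -/
noncomputable def gaussianPdf (n : ℕ) (Λ : Matrix (Fin n) (Fin n) ℝ) (x : Fin n → ℝ) : ℝ :=
  (Real.sqrt ((2 * Real.pi) ^ n * Λ.det))⁻¹ * Real.exp (-(x ⬝ᵥ (Λ⁻¹ *ᵥ x)) / 2)

/-- The centered multivariate Gaussian measure `N(0, Λ)` on `ℝⁿ`. -/
noncomputable def gaussianMeasure (n : ℕ) (Λ : Matrix (Fin n) (Fin n) ℝ) :
    Measure (Fin n → ℝ) :=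
  volume.withDensity fun x => ENNReal.ofReal (gaussianPdf n Λ x)

/-- The standard normal cumulative distribution function `Φ`. -/
noncomputable def stdNormalCDF (t : ℝ) : ℝ :=
  ∫ x in Set.Iic t, Real.exp (-x ^ 2 / 2) / Real.sqrt (2 * Real.pi)

open ProbabilityTheory Asymptotics
open scoped NNReal ENNReal Topology

/-- A product of complex numbers in the unit disc is 1-Lipschitz in the `ℓ¹` distance. -/
lemma norm_prod_sub_prod_le_sum {ι : Type*} (s : Finset ι) (f g : ι → ℂ)
    (hf : ∀ i, ‖f i‖ ≤ 1) (hg : ∀ i, ‖g i‖ ≤ 1) :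
    ‖∏ i ∈ s, f i - ∏ i ∈ s, g i‖ ≤ ∑ i ∈ s, ‖f i - g i‖ := by
  classical
  induction s using Finset.induction_on with
  | empty => simp
  | insert i s hi ih =>
    rw [Finset.prod_insert hi, Finset.prod_insert hi, Finset.sum_insert hi]
    have hfs : ‖∏ j ∈ s, f j‖ ≤ 1 := by
      rw [norm_prod]
      exact Finset.prod_le_one (fun _ _ ↦ norm_nonneg _) fun j _ ↦ hf j
    calc ‖f i * ∏ j ∈ s, f j - g i * ∏ j ∈ s, g j‖
        = ‖(f i - g i) * ∏ j ∈ s, f j + g i * (∏ j ∈ s, f j - ∏ j ∈ s, g j)‖ := by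
          congr 1; ring
      _ ≤ ‖f i - g i‖ * ‖∏ j ∈ s, f j‖ + ‖g i‖ * ‖∏ j ∈ s, f j - ∏ j ∈ s, g j‖ := by
          simpa only [norm_mul] using norm_add_le ((f i - g i) * ∏ j ∈ s, f j)
            (g i * (∏ j ∈ s, f j - ∏ j ∈ s, g j))
      _ ≤ ‖f i - g i‖ * 1 + 1 * ∑ j ∈ s, ‖f j - g j‖ := by
          gcongr
          exact hg i
      _ = _ := by ring

lemma isLittleO_exp_neg_sq_half :
    (fun u : ℝ ↦ Complex.exp (-(u : ℂ) ^ 2 / 2) - (1 - (u : ℂ) ^ 2 / 2)) =o[𝓝 0]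
      fun u : ℝ ↦ (u : ℂ) ^ 2 := by
  have h : (fun z : ℂ ↦ Complex.exp z - 1 - z) =o[𝓝 0] fun z ↦ z := by
    simpa [hasDerivAt_iff_isLittleO] using Complex.hasDerivAt_exp 0
  have ht : Tendsto (fun u : ℝ ↦ -(u : ℂ) ^ 2 / 2) (𝓝 0) (𝓝 0) := by
    have : Continuous fun u : ℝ ↦ -(u : ℂ) ^ 2 / 2 := by fun_prop
    simpa using this.tendsto 0
  have h2 := h.comp_tendsto ht
  have h3 : ((fun z : ℂ ↦ z) ∘ fun u : ℝ ↦ -(u : ℂ) ^ 2 / 2) =O[𝓝 0]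
      fun u : ℝ ↦ (u : ℂ) ^ 2 := by
    refine IsBigO.of_bound 1 (.of_forall fun u ↦ ?_)
    simp only [Function.comp, norm_div, norm_neg, one_mul]
    have := norm_nonneg ((u : ℂ) ^ 2)
    norm_num at this ⊢
    linarith
  refine (h2.trans_isBigO h3).congr_left fun u ↦ ?_
  simp only [Function.comp]
  ring

/-- The characteristic-function form of the Lindeberg central limit theorem for weighted sums of
copies of one centered and normalized random variable with characteristic function `φ`. -/
lemma tendsto_prod_charFun_of_weights {φ : ℝ → ℂ} (hφ1 : ∀ t, ‖φ t‖ ≤ 1)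
    (hφ : (fun t ↦ φ t - (1 - (t : ℂ) ^ 2 / 2)) =o[𝓝 0] fun t : ℝ ↦ (t : ℂ) ^ 2)
    (w : (n : ℕ) → Fin n → ℝ) (hw : ∀ᶠ n in atTop, ∑ k, w n k ^ 2 = 1)
    (hw0 : ∀ ε > 0, ∀ᶠ n in atTop, ∀ k, |w n k| ≤ ε) (t : ℝ) :
    Tendsto (fun n ↦ ∏ k, φ (t * w n k)) atTop (𝓝 (Complex.exp (-(t : ℂ) ^ 2 / 2))) := by
  have hd := hφ.sub isLittleO_exp_neg_sq_half
  rw [Metric.tendsto_atTop']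
  intro ε hε
  have hη : 0 < ε / (2 * (t ^ 2 + 1)) := by positivity
  have hb := hd.bound hη
  obtain ⟨δ, hδ, hball⟩ := Metric.eventually_nhds_iff.1 hb
  have hev : ∀ᶠ n in atTop, dist (∏ k, φ (t * w n k)) (Complex.exp (-(t : ℂ) ^ 2 / 2)) < ε := by
    filter_upwards [hw, hw0 (δ / (2 * (|t| + 1))) (by positivity)] with n hn hn0
    have hexp : Complex.exp (-(t : ℂ) ^ 2 / 2)
        = ∏ k, Complex.exp (-((t * w n k : ℝ) : ℂ) ^ 2 / 2) := by
      rw [← Complex.exp_sum]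
      congr 1
      have : (∑ k, ((w n k : ℝ) : ℂ) ^ 2) = 1 := by exact_mod_cast hn
      calc -(t : ℂ) ^ 2 / 2 = -(t : ℂ) ^ 2 / 2 * ∑ k, ((w n k : ℝ) : ℂ) ^ 2 := by rw [this, mul_one]
        _ = _ := by
          rw [Finset.mul_sum]
          refine Finset.sum_congr rfl fun k _ ↦ ?_
          push_cast; ring
    rw [hexp, dist_eq_norm]
    calc _ ≤ ∑ k, ‖φ (t * w n k) - Complex.exp (-((t * w n k : ℝ) : ℂ) ^ 2 / 2)‖ := by
          refine norm_prod_sub_prod_le_sum _ _ _ (fun _ ↦ hφ1 _) fun k ↦ ?_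
          have : -((t * w n k : ℝ) : ℂ) ^ 2 / 2 = ((-(t * w n k) ^ 2 / 2 : ℝ) : ℂ) := by
            push_cast; ring
          rw [this, Complex.norm_exp, Complex.ofReal_re, Real.exp_le_one_iff]
          nlinarith [sq_nonneg (t * w n k)]
      _ ≤ ∑ k, ε / (2 * (t ^ 2 + 1)) * (t ^ 2 * w n k ^ 2) := by
          refine Finset.sum_le_sum fun k _ ↦ ?_
          have hk : dist (t * w n k) 0 < δ := by
            rw [Real.dist_eq, sub_zero, abs_mul]
            calc |t| * |w n k| ≤ (|t| + 1) * (δ / (2 * (|t| + 1))) := by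
                  gcongr
                  · linarith
                  · exact hn0 k
              _ = δ / 2 := by field_simp
              _ < δ := by linarith
          have := hball hk
          rw [norm_pow, Complex.norm_real, Real.norm_eq_abs, sq_abs, mul_pow] at this
          rwa [sub_sub_sub_cancel_right] at this
      _ = ε / 2 * (t ^ 2 / (t ^ 2 + 1)) := by
          rw [← Finset.mul_sum, ← Finset.mul_sum, hn]
          field_simp
      _ ≤ ε / 2 * 1 := by
          gcongr
          rw [div_le_one (by positivity)]
          linarith
      _ < ε := by linarith
  obtain ⟨N, hN⟩ := eventually_atTop.1 hev
  exact ⟨N, fun n hn ↦ hN n hn.le⟩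

lemma integral_sq_gaussianReal_zero_one : ∫ x, x ^ 2 ∂gaussianReal 0 1 = 1 := by
  have h := variance_eq_sub (memLp_id_gaussianReal' (μ := 0) (v := 1) 2 (by simp))
  rw [variance_id_gaussianReal] at h
  simpa using h.symm

lemma integral_pow_four_gaussianReal_zero_one : ∫ x, x ^ 4 ∂gaussianReal 0 1 = 3 := by
  rw [integral_gaussianReal_eq_integral_smul one_ne_zero]
  have h1 : ∀ x : ℝ, gaussianPDFReal 0 1 x • x ^ 4
      = (fun y : ℝ ↦ (√(2 * Real.pi))⁻¹ * (y ^ (4 : ℝ) * Real.exp (-(1 / 2) * y ^ (2 : ℝ)))) |x| := by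
    intro x
    simp only [gaussianPDFReal, smul_eq_mul, NNReal.coe_one, mul_one, sub_zero]
    norm_cast
    rw [sq_abs, (even_iff_two_dvd.2 (by norm_num : 2 ∣ 4)).pow_abs]
    ring_nf
  rw [integral_congr_ae (.of_forall h1), integral_comp_abs
      (f := fun y : ℝ ↦ (√(2 * Real.pi))⁻¹ * (y ^ (4 : ℝ) * Real.exp (-(1 / 2) * y ^ (2 : ℝ)))),
    integral_const_mul,
    integral_rpow_mul_exp_neg_mul_rpow (by norm_num) (by norm_num) (by norm_num)]
  have hG : Real.Gamma ((4 + 1) / 2) = 3 * √Real.pi / 4 := by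
    have := Real.Gamma_nat_add_half 2
    norm_num [Nat.doubleFactorial] at this
    norm_num [this]
  have hp : ((1 : ℝ) / 2) ^ (-(4 + 1) / 2 : ℝ) = 4 * √2 := by
    rw [one_div, Real.inv_rpow (by norm_num), ← Real.rpow_neg (by norm_num),
      show -(-(4 + 1) / 2 : ℝ) = 2 + 1 / 2 by norm_num, Real.rpow_add (by norm_num),
      ← Real.sqrt_eq_rpow]
    norm_num
  rw [hG, hp, Real.sqrt_mul (by norm_num)]
  have : √Real.pi ≠ 0 := by positivity
  field_simp

/-- The law of `(Z ^ 2 - 1) / √2` for a standard normal variable `Z`. -/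
noncomputable def normalizedChiSq : Measure ℝ :=
  (gaussianReal 0 1).map fun x ↦ (x ^ 2 - 1) / √2

instance isProbabilityMeasure_normalizedChiSq : IsProbabilityMeasure normalizedChiSq :=
  Measure.isProbabilityMeasure_map (by fun_prop)

lemma charFun_normalizedChiSq_isLittleO :
    (fun t ↦ charFun normalizedChiSq t - (1 - (t : ℂ) ^ 2 / 2)) =o[𝓝 0]
      fun t : ℝ ↦ (t : ℂ) ^ 2 := by
  have hi (k : ℕ) : Integrable (fun x : ℝ ↦ x ^ k) (gaussianReal 0 1) := by
    have := (memLp_id_gaussianReal' (μ := 0) (v := 1) k (by simp)).integrable_norm_pow'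
    refine this.mono' (by fun_prop) (.of_forall fun x ↦ ?_)
    simp
  have h := taylor_charFun_two (P := gaussianReal 0 1) (X := fun x ↦ (x ^ 2 - 1) / √2)
    (by fun_prop) ?_ ?_
  · refine h.trans_isBigO (IsBigO.of_bound 1 (.of_forall fun t ↦ ?_))
    simp
  · rw [integral_div, integral_sub (hi 2) (by simp), integral_sq_gaussianReal_zero_one]
    simp
  · have : ∀ x : ℝ, ((fun x : ℝ ↦ (x ^ 2 - 1) / √2) ^ 2) x = (x ^ 4 - 2 * x ^ 2 + 1) / 2 := by
      intro x
      simp only [Pi.pow_apply, div_pow, Real.sq_sqrt (zero_le_two : (0 : ℝ) ≤ 2)]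
      ring
    simp_rw [this]
    rw [integral_div, integral_add (f := fun x : ℝ ↦ x ^ 4 - 2 * x ^ 2)
        ((hi 4).sub ((hi 2).const_mul 2)) (by simp),
      integral_sub (hi 4) ((hi 2).const_mul 2), integral_const_mul,
      integral_sq_gaussianReal_zero_one, integral_pow_four_gaussianReal_zero_one]
    norm_num

lemma gaussianPdf_diagonal {n : ℕ} {κ : Fin n → ℝ} (hκ : ∀ k, 0 < κ k) (x : Fin n → ℝ) :
    gaussianPdf n (Matrix.diagonal κ) x
      = ∏ k, gaussianPDFReal 0 (κ k).toNNReal (x k) := by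
  have hinv : (Matrix.diagonal κ)⁻¹ = Matrix.diagonal fun k ↦ (κ k)⁻¹ := by
    refine Matrix.inv_eq_left_inv ?_
    rw [Matrix.diagonal_mul_diagonal, ← Matrix.diagonal_one]
    congr 1
    ext k
    exact inv_mul_cancel₀ (hκ k).ne'
  have hdet : (2 * Real.pi) ^ n * (Matrix.diagonal κ).det = ∏ k, (2 * Real.pi * κ k) := by
    rw [Matrix.det_diagonal, Finset.prod_mul_distrib]
    simp
  have hquad : -(x ⬝ᵥ ((Matrix.diagonal fun k ↦ (κ k)⁻¹) *ᵥ x)) / 2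
      = ∑ k, -(x k - 0) ^ 2 / (2 * κ k) := by
    simp only [dotProduct, Matrix.mulVec_diagonal, ← Finset.sum_neg_distrib, Finset.sum_div]
    refine Finset.sum_congr rfl fun k _ ↦ ?_
    have := (hκ k).ne'
    field_simp
    ring
  rw [gaussianPdf, hinv, hdet, hquad, Real.exp_sum,
    Real.sqrt_prod _ fun k _ ↦ by have := (hκ k).le; positivity, ← Finset.prod_inv_distrib,
    ← Finset.prod_mul_distrib]
  refine Finset.prod_congr rfl fun k _ ↦ ?_
  rw [gaussianPDFReal, Real.coe_toNNReal _ (hκ k).le]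

lemma gaussianMeasure_diagonal {n : ℕ} {κ : Fin n → ℝ} (hκ : ∀ k, 0 < κ k) :
    gaussianMeasure n (Matrix.diagonal κ)
      = Measure.pi fun k ↦ gaussianReal 0 (κ k).toNNReal := by
  symm
  refine Measure.pi_eq fun s hs ↦ ?_
  have hv : ∀ k, (κ k).toNNReal ≠ 0 := fun k ↦ by simpa using hκ k
  simp_rw [gaussianReal_apply_eq_integral _ (hv _)]
  rw [gaussianMeasure, withDensity_apply _ (MeasurableSet.univ_pi hs)]
  simp_rw [gaussianPdf_diagonal hκ]
  rw [volume_pi, Measure.restrict_pi_pi, ← ofReal_integral_eq_lintegral_ofReal,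
    integral_fintype_prod_eq_prod (fun k x ↦ gaussianPDFReal 0 (κ k).toNNReal x),
    ENNReal.ofReal_prod_of_nonneg]
  · exact fun k _ ↦ integral_nonneg fun _ ↦ gaussianPDFReal_nonneg _ _ _
  · exact Integrable.fintype_prod fun k ↦ (integrable_gaussianPDFReal _ _).restrict
  · exact .of_forall fun _ ↦ Finset.prod_nonneg fun _ _ ↦ gaussianPDFReal_nonneg _ _ _

lemma measurable_gaussianPdf_diagonal {n : ℕ} {κ : Fin n → ℝ} (hκ : ∀ k, 0 < κ k) :
    Measurable (gaussianPdf n (Matrix.diagonal κ)) := by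
  rw [funext (gaussianPdf_diagonal hκ)]
  exact Finset.measurable_prod _ fun k _ ↦
    (measurable_gaussianPDFReal _ _).comp (measurable_pi_apply k)

lemma gaussianPdf_diagonal_pos {n : ℕ} {κ : Fin n → ℝ} (hκ : ∀ k, 0 < κ k) (x : Fin n → ℝ) :
    0 < gaussianPdf n (Matrix.diagonal κ) x := by
  rw [gaussianPdf_diagonal hκ]
  exact Finset.prod_pos fun k _ ↦ gaussianPDFReal_pos _ _ _ (by simpa using hκ k)

/-- The Radon–Nikodym derivative of two nondegenerate diagonal Gaussians is the ratio of their
densities. -/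
lemma rnDeriv_gaussianMeasure_diagonal {n : ℕ} {κ l : Fin n → ℝ} (hκ : ∀ k, 0 < κ k)
    (hl : ∀ k, 0 < l k) :
    ∀ᵐ x ∂gaussianMeasure n (Matrix.diagonal κ),
      ((gaussianMeasure n (Matrix.diagonal κ)).rnDeriv
        (gaussianMeasure n (Matrix.diagonal l)) x).toReal
        = gaussianPdf n (Matrix.diagonal κ) x / gaussianPdf n (Matrix.diagonal l) x := by
  have hmκ := measurable_gaussianPdf_diagonal hκ
  have hml := measurable_gaussianPdf_diagonal hl
  have hdens : gaussianMeasure n (Matrix.diagonal κ)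
      = (gaussianMeasure n (Matrix.diagonal l)).withDensity fun x ↦ ENNReal.ofReal
        (gaussianPdf n (Matrix.diagonal κ) x / gaussianPdf n (Matrix.diagonal l) x) := by
    rw [gaussianMeasure, gaussianMeasure, ← withDensity_mul _ (by fun_prop) (by fun_prop)]
    congr 1
    ext x
    have := gaussianPdf_diagonal_pos hl x
    rw [Pi.mul_apply, ← ENNReal.ofReal_mul this.le, mul_div_cancel₀ _ this.ne']
  have hac : gaussianMeasure n (Matrix.diagonal κ) ≪ gaussianMeasure n (Matrix.diagonal l) := by
    rw [hdens]
    exact withDensity_absolutelyContinuous _ _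
  have : SigmaFinite (gaussianMeasure n (Matrix.diagonal l)) := by
    rw [gaussianMeasure_diagonal hl]
    infer_instance
  refine hac.ae_le ?_
  have h := Measure.rnDeriv_withDensity (gaussianMeasure n (Matrix.diagonal l))
    (f := fun x ↦ ENNReal.ofReal
        (gaussianPdf n (Matrix.diagonal κ) x / gaussianPdf n (Matrix.diagonal l) x)) (by fun_prop)
  rw [← hdens] at h
  filter_upwards [h] with x hx
  rw [hx, ENNReal.toReal_ofReal
    (div_pos (gaussianPdf_diagonal_pos hκ x) (gaussianPdf_diagonal_pos hl x)).le]

lemma log_gaussianPdf_diagonal_div_one {n : ℕ} {κ : Fin n → ℝ} (hκ : ∀ k, 0 < κ k)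
    (x : Fin n → ℝ) :
    Real.log (gaussianPdf n (Matrix.diagonal κ) x / gaussianPdf n (Matrix.diagonal 1) x)
      = ∑ k, ((1 - (κ k)⁻¹) * x k ^ 2 - Real.log (κ k)) / 2 := by
  rw [gaussianPdf_diagonal hκ, gaussianPdf_diagonal (fun _ ↦ by simp), ← Finset.prod_div_distrib,
    Real.log_prod fun k _ ↦ (div_pos (gaussianPDFReal_pos _ _ _ (by simpa using hκ k))
      (gaussianPDFReal_pos _ _ _ (by simp))).ne']
  refine Finset.sum_congr rfl fun k _ ↦ ?_
  have h2 : (0 : ℝ) < 2 * Real.pi := by positivity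
  have h := hκ k
  have hlog : ∀ v : ℝ≥0, v ≠ 0 → Real.log (gaussianPDFReal 0 v (x k))
      = -(Real.log (2 * Real.pi) + Real.log v) / 2 - x k ^ 2 / (2 * v) := by
    intro v hv
    have hv' : (v : ℝ) ≠ 0 := by exact_mod_cast hv
    have hv0 : (0 : ℝ) < v := by positivity
    rw [gaussianPDFReal, Real.log_mul (by positivity) (Real.exp_pos _).ne', Real.log_exp,
      Real.log_inv, Real.log_sqrt (by positivity), Real.log_mul h2.ne' hv']
    ring
  rw [Real.log_div (gaussianPDFReal_pos _ _ _ (by simpa using h)).ne'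
    (gaussianPDFReal_pos _ _ _ (by simp)).ne', hlog _ (by simpa using h), hlog _ (by simp),
    Real.coe_toNNReal _ h.le]
  simp
  field_simp
  ring

lemma charFun_map_weighted_sum {n : ℕ} {κ : Fin n → ℝ} (hκ : ∀ k, 0 < κ k) (w : Fin n → ℝ)
    (t : ℝ) :
    charFun ((gaussianMeasure n (Matrix.diagonal κ)).map
      fun x ↦ ∑ k, w k * ((x k ^ 2 / κ k - 1) / √2)) t
      = ∏ k, charFun normalizedChiSq (t * w k) := by
  have hm : Measurable fun x : Fin n → ℝ ↦ ∑ k, w k * ((x k ^ 2 / κ k - 1) / √2) := by fun_prop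
  rw [gaussianMeasure_diagonal hκ, charFun_apply_real,
    integral_map hm.aemeasurable (by fun_prop)]
  have hprod : ∀ x : Fin n → ℝ, Complex.exp (t *
      ((∑ k, w k * ((x k ^ 2 / κ k - 1) / √2) : ℝ) : ℂ) * Complex.I)
      = ∏ k, (fun (k : Fin n) (y : ℝ) ↦ Complex.exp (((t * w k : ℝ) : ℂ) *
        (((y ^ 2 / κ k - 1) / √2 : ℝ) : ℂ) * Complex.I)) k (x k) := by
    intro x
    simp only
    rw [← Complex.exp_sum, Complex.ofReal_sum, Finset.mul_sum, Finset.sum_mul]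
    congr 1
    refine Finset.sum_congr rfl fun k _ ↦ ?_
    push_cast
    ring
  rw [integral_congr_ae (.of_forall hprod), integral_fintype_prod_eq_prod (fun (k : Fin n) (y : ℝ) ↦
    Complex.exp (((t * w k : ℝ) : ℂ) * (((y ^ 2 / κ k - 1) / √2 : ℝ) : ℂ) * Complex.I))]
  refine Finset.prod_congr rfl fun k _ ↦ ?_
  have hlaw : gaussianReal 0 (κ k).toNNReal
      = (gaussianReal 0 1).map fun z ↦ √(κ k) * z := by
    rw [gaussianReal_map_const_mul]
    congr 1
    · simp
    · ext
      simp [Real.sq_sqrt (hκ k).le, (hκ k).le]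
  rw [hlaw, integral_map (by fun_prop) (by fun_prop), normalizedChiSq, charFun_apply_real,
    integral_map (by fun_prop) (by fun_prop)]
  refine integral_congr_ae (.of_forall fun z ↦ ?_)
  simp only [mul_pow, Real.sq_sqrt (hκ k).le, mul_div_cancel_left₀ _ (hκ k).ne']

lemma stdNormalCDF_eq_gaussianReal (t : ℝ) :
    stdNormalCDF t = (gaussianReal 0 1 (Set.Iic t)).toReal := by
  rw [gaussianReal_apply_eq_integral _ one_ne_zero, ENNReal.toReal_ofReal
    (integral_nonneg fun _ ↦ gaussianPDFReal_nonneg _ _ _), stdNormalCDF]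
  congr 1
  ext x
  simp [gaussianPDFReal, div_eq_inv_mul]

/-- **Asymptotic normality of the log-likelihood ratio for diagonal Gaussian hypotheses.**
For each `n` let `κ_{n,1}, …, κ_{n,n} ∈ [a, b] ⊆ (0, ∞)`, set
`B_n = (Σ_k (κ_{n,k} - 1)²)^{1/2}` and assume `B_n ≥ c √n` eventually for some `c > 0`. Let
`p⁽ⁿ⁾ = N(0, diag κ_n)`, `q⁽ⁿ⁾ = N(0, I_n)`, with relative entropy (in nats)
`D_n = (1/2)(Σ_k κ_{n,k} - Σ_k ln κ_{n,k} - n)`. If `X⁽ⁿ⁾ ∼ p⁽ⁿ⁾`, then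
`(ln ((dp⁽ⁿ⁾/dq⁽ⁿ⁾)(X⁽ⁿ⁾)) - D_n) √2 / B_n` converges in distribution to `N(0,1)`, i.e. its
CDF under `p⁽ⁿ⁾` converges pointwise to the standard normal CDF. -/
theorem loglikelihood_ratio_clt_diagonal_gaussian
    (κ : (n : ℕ) → Fin n → ℝ) (a b : ℝ) (ha : 0 < a) (hab : a ≤ b)
    (hκ : ∀ n, ∀ k : Fin n, a ≤ κ n k ∧ κ n k ≤ b)
    (B : ℕ → ℝ) (hB : ∀ n, B n = Real.sqrt (∑ k : Fin n, (κ n k - 1) ^ 2))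
    (c : ℝ) (hc : 0 < c) (hBc : ∀ᶠ n : ℕ in atTop, c * Real.sqrt (n : ℝ) ≤ B n)
    (D : ℕ → ℝ)
    (hD : ∀ n, D n = (1 / 2) *
      ((∑ k : Fin n, κ n k) - (∑ k : Fin n, Real.log (κ n k)) - (n : ℝ))) :
    ∀ t : ℝ, Tendsto (fun n : ℕ =>
        ((gaussianMeasure n (Matrix.diagonal (κ n)))
          {x | (Real.log (((gaussianMeasure n (Matrix.diagonal (κ n))).rnDeriv
                  (gaussianMeasure n (1 : Matrix (Fin n) (Fin n) ℝ)) x).toReal)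
                - D n) * Real.sqrt 2 / B n ≤ t}).toReal)
      atTop (nhds (stdNormalCDF t)) := by
  intro t
  have hpos : ∀ n, ∀ k : Fin n, 0 < κ n k := fun n k ↦ ha.trans_le (hκ n k).1
  set W : (n : ℕ) → (Fin n → ℝ) → ℝ :=
    fun n x ↦ ∑ k, (κ n k - 1) / B n * ((x k ^ 2 / κ n k - 1) / √2) with hW
  have hWm : ∀ n, Measurable (W n) := fun n ↦ by fun_prop
  have hprob : ∀ n, IsProbabilityMeasure (gaussianMeasure n (Matrix.diagonal (κ n))) := by
    intro n
    rw [gaussianMeasure_diagonal (hpos n)]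
    infer_instance
  have hset : ∀ n, (gaussianMeasure n (Matrix.diagonal (κ n)))
      {x | (Real.log (((gaussianMeasure n (Matrix.diagonal (κ n))).rnDeriv
              (gaussianMeasure n (1 : Matrix (Fin n) (Fin n) ℝ)) x).toReal)
            - D n) * Real.sqrt 2 / B n ≤ t}
      = (gaussianMeasure n (Matrix.diagonal (κ n))).map (W n) (Set.Iic t) := by
    intro n
    rw [Measure.map_apply (hWm n) measurableSet_Iic, ← Matrix.diagonal_one]
    refine measure_congr ?_
    filter_upwards [rnDeriv_gaussianMeasure_diagonal (hpos n) (l := 1) (fun _ ↦ by simp)] with x hx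
    have hval : (Real.log (((gaussianMeasure n (Matrix.diagonal (κ n))).rnDeriv
        (gaussianMeasure n (Matrix.diagonal 1)) x).toReal) - D n) * √2 / B n = W n x := by
      have hD' : D n = ∑ k, (κ n k - Real.log (κ n k) - 1) / 2 := by
        rw [hD, ← Finset.sum_div, Finset.sum_sub_distrib, Finset.sum_sub_distrib]
        simp
        ring
      rw [hx, log_gaussianPdf_diagonal_div_one (hpos n), hD', ← Finset.sum_sub_distrib,
        Finset.sum_mul, Finset.sum_div, hW]
      refine Finset.sum_congr rfl fun k _ ↦ ?_
      have hk := (hpos n k).ne'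
      have h2 : √2 = 2 / √2 := by
        rw [eq_div_iff (by positivity)]
        exact Real.mul_self_sqrt zero_le_two
      have hA : (1 - (κ n k)⁻¹) * x k ^ 2 - Real.log (κ n k) - (κ n k - Real.log (κ n k) - 1)
          = (κ n k - 1) * (x k ^ 2 / κ n k - 1) := by
        field_simp
        ring
      linear_combination √2 / (2 * B n) * hA
        + (κ n k - 1) * (x k ^ 2 / κ n k - 1) / (2 * B n) * h2
    exact congrArg (· ≤ t) hval
  have hconv : Tendsto (β := ProbabilityMeasure ℝ)
      (fun n ↦ ⟨(gaussianMeasure n (Matrix.diagonal (κ n))).map (W n),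
        Measure.isProbabilityMeasure_map (hWm n).aemeasurable⟩) atTop
      (𝓝 ⟨gaussianReal 0 1, inferInstance⟩) := by
    refine ProbabilityMeasure.tendsto_iff_tendsto_charFun.2 fun s ↦ ?_
    have hBpos : ∀ᶠ n in atTop, 0 < B n := by
      filter_upwards [hBc, eventually_gt_atTop 0] with n hn hn0
      exact lt_of_lt_of_le (by positivity) hn
    have key := tendsto_prod_charFun_of_weights (φ := charFun normalizedChiSq)
      norm_charFun_le_one charFun_normalizedChiSq_isLittleO
      (fun n k ↦ (κ n k - 1) / B n) ?_ ?_ s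
    · simp only [ProbabilityMeasure.coe_mk, hW]
      simp_rw [charFun_map_weighted_sum (hpos _)]
      simpa [charFun_gaussianReal, neg_div] using key
    · filter_upwards [hBpos] with n hn
      simp_rw [div_pow]
      rw [← Finset.sum_div, ← Real.sq_sqrt (Finset.sum_nonneg fun k _ ↦ sq_nonneg (κ n k - 1)),
        ← hB]
      exact div_self (by positivity)
    · intro ε hε
      have hlim : Tendsto (fun n : ℕ ↦ c * √(n : ℝ)) atTop atTop :=
        (Real.tendsto_sqrt_atTop.comp tendsto_natCast_atTop_atTop).const_mul_atTop hc
      filter_upwards [hBpos, hBc, hlim.eventually_ge_atTop ((b + 1) / ε)] with n hn hn1 hn2 k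
      rw [abs_div, abs_of_pos hn, div_le_iff₀ hn]
      have h1 : b + 1 ≤ ε * B n := by
        rw [div_le_iff₀ hε] at hn2
        nlinarith
      have h2 := hκ n k
      exact (abs_le.2 ⟨by linarith, by linarith⟩ : |κ n k - 1| ≤ b + 1).trans h1
  rw [stdNormalCDF_eq_gaussianReal]
  simp_rw [hset]
  have := nullSingletonClass_gaussianReal (μ := 0) (one_ne_zero : (1 : ℝ≥0) ≠ 0)
  exact (ENNReal.tendsto_toReal (measure_ne_top _ _)).comp
    (ProbabilityMeasure.tendsto_measure_of_null_frontier_of_tendsto' hconv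
      (E := Set.Iic t) (by simp))
end

section
/- For n ≥ 3, let p^{(n)} be the uniform probability measure on [0,1]ⁿ and let q^{(n)} be the probability measure on [0,1]ⁿ with density (with respect to Lebesgue measure) equal to n − √n on the set { x : max_i |x_i| ≤ n^{−1/n} } and equal to √n/(n−1) on its complement in [0,1]ⁿ (this is a valid density since the set { x ∈ [0,1]ⁿ : max_i |x_i| ≤ n^{−1/n} } has Lebesgue measure 1/n). Then the relative entropy satisfies D(p^{(n)} ‖ q^{(n)}) = (1/n) log₂( 1/(n − √n) ) + (1 − 1/n) log₂( (n−1)/√n ), and consequently D(p^{(n)} ‖ q^{(n)}) / log₂(√n) → 1 as n → ∞; in particular D(p^{(n)} ‖ q^{(n)}) → ∞ while D(p^{(n)} ‖ q^{(n)})/n → 0. -/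
open MeasureTheory Filter

/-- The unit cube `[0,1]ⁿ` in `ℝⁿ`. -/
def unitCube (n : ℕ) : Set (Fin n → ℝ) := {x | ∀ i, x i ∈ Set.Icc (0 : ℝ) 1}

/-- The uniform probability measure on `[0,1]ⁿ`. -/
noncomputable def uniformCube (n : ℕ) : Measure (Fin n → ℝ) :=
  volume.restrict (unitCube n)

/-- The density of the measure `q⁽ⁿ⁾` on `[0,1]ⁿ`: equal to `n - √n` on
`{x : max_i |x_i| ≤ n^(-1/n)}` and `√n / (n - 1)` elsewhere. -/
noncomputable def qDensity (n : ℕ) (x : Fin n → ℝ) : ℝ :=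
  if ∀ i, |x i| ≤ (n : ℝ) ^ (-(1 : ℝ) / n) then (n : ℝ) - Real.sqrt n
  else Real.sqrt n / ((n : ℝ) - 1)

/-- The probability measure `q⁽ⁿ⁾` on `[0,1]ⁿ` with density `qDensity n` with respect to
Lebesgue measure on the unit cube. -/
noncomputable def qCube (n : ℕ) : Measure (Fin n → ℝ) :=
  (volume.restrict (unitCube n)).withDensity fun x => ENNReal.ofReal (qDensity n x)

/-- The relative entropy `D(p ‖ q) = ∫ log₂ (dp/dq) dp` in bits. -/
noncomputable def relEntropyBits {X : Type*} [MeasurableSpace X] (p q : Measure X) : ℝ :=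
  ∫ x, Real.logb 2 ((p.rnDeriv q x).toReal) ∂p

/-- The cube `{x : max_i |x_i| ≤ r}`. -/
def centeredCube (n : ℕ) (r : ℝ) : Set (Fin n → ℝ) := {x | ∀ i, |x i| ≤ r}

theorem measurableSet_centeredCube (n : ℕ) (r : ℝ) : MeasurableSet (centeredCube n r) := by
  have : centeredCube n r = Set.univ.pi fun _ => Set.Icc (-r) r := by
    ext x; simp only [centeredCube, Set.mem_ofPred_eq, Set.mem_univ_pi, Set.mem_Icc, abs_le]
  rw [this]
  exact MeasurableSet.univ_pi fun _ => measurableSet_Icc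

theorem uniformCube_centeredCube (n : ℕ) {r : ℝ} (hr₀ : 0 ≤ r) (hr₁ : r ≤ 1) :
    uniformCube n (centeredCube n r) = ENNReal.ofReal (r ^ n) := by
  have h : centeredCube n r ∩ unitCube n = Set.univ.pi fun _ => Set.Icc (0 : ℝ) r := by
    ext x
    simp only [centeredCube, unitCube, Set.mem_inter_iff, Set.mem_ofPred_eq, Set.mem_Icc,
      Set.mem_univ_pi, abs_le, ← forall_and]
    refine forall_congr' fun i => ⟨fun h => ⟨h.2.1, h.1.2⟩, fun h => ?_⟩
    exact ⟨⟨by linarith [h.1], h.2⟩, h.1, h.2.trans hr₁⟩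
  rw [uniformCube, Measure.restrict_apply (measurableSet_centeredCube n r), h, volume_pi_pi]
  simp [ENNReal.ofReal_pow hr₀]

instance isProbabilityMeasure_uniformCube (n : ℕ) : IsProbabilityMeasure (uniformCube n) := by
  constructor
  have h : unitCube n = Set.univ.pi fun _ => Set.Icc (0 : ℝ) 1 := by
    ext x; simp only [unitCube, Set.mem_ofPred_eq, Set.mem_univ_pi]
  rw [uniformCube, Measure.restrict_apply_univ, h, volume_pi_pi]
  simp

theorem measureReal_uniformCube_centeredCube {n : ℕ} (hn : 1 ≤ n) :
    (uniformCube n).real (centeredCube n ((n : ℝ) ^ (-(1 : ℝ) / n))) = 1 / (n : ℝ) := by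
  have hn' : (1 : ℝ) ≤ n := by exact_mod_cast hn
  have hr₀ : 0 ≤ (n : ℝ) ^ (-(1 : ℝ) / n) := by positivity
  have hr₁ : (n : ℝ) ^ (-(1 : ℝ) / n) ≤ 1 :=
    Real.rpow_le_one_of_one_le_of_nonpos hn' (div_nonpos_of_nonpos_of_nonneg (by norm_num)
      (by positivity))
  rw [measureReal_def, uniformCube_centeredCube n hr₀ hr₁, ENNReal.toReal_ofReal (by positivity),
    ← Real.rpow_natCast, ← Real.rpow_mul (by positivity),
    div_mul_cancel₀ _ (by positivity), Real.rpow_neg_one, one_div]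

theorem sqrt_lt_self_of_one_lt {x : ℝ} (hx : 1 < x) : Real.sqrt x < x := by
  rw [Real.sqrt_lt' (by linarith)]
  nlinarith

theorem qDensity_pos {n : ℕ} (hn : 2 ≤ n) (x : Fin n → ℝ) : 0 < qDensity n x := by
  have hn' : (1 : ℝ) < n := by exact_mod_cast hn
  unfold qDensity
  split_ifs
  · exact sub_pos.2 (sqrt_lt_self_of_one_lt hn')
  · exact div_pos (Real.sqrt_pos.2 (by linarith)) (by linarith)

theorem measurable_qDensity (n : ℕ) : Measurable (qDensity n) :=
  Measurable.ite (measurableSet_centeredCube n _) measurable_const measurable_const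

theorem rnDeriv_uniformCube_qCube {n : ℕ} (hn : 2 ≤ n) :
    ∀ᵐ x ∂uniformCube n,
      ((uniformCube n).rnDeriv (qCube n) x).toReal = (qDensity n x)⁻¹ := by
  have hd := Measure.rnDeriv_withDensity_right (uniformCube n) (uniformCube n)
    (f := fun x => ENNReal.ofReal (qDensity n x))
    (measurable_qDensity n).ennreal_ofReal.aemeasurable
    (ae_of_all _ fun x => (ENNReal.ofReal_pos.2 (qDensity_pos hn x)).ne')
    (ae_of_all _ fun x => ENNReal.ofReal_ne_top)
  filter_upwards [hd, (uniformCube n).rnDeriv_self] with x hx hx'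
  change ((uniformCube n).rnDeriv ((uniformCube n).withDensity _) x).toReal = _
  rw [hx, hx']
  simp [ENNReal.toReal_ofReal (qDensity_pos hn x).le]

theorem relEntropyBits_uniformCube_qCube {n : ℕ} (hn : 2 ≤ n) :
    relEntropyBits (uniformCube n) (qCube n) =
      (1 / (n : ℝ)) * Real.logb 2 (1 / ((n : ℝ) - Real.sqrt n)) +
        (1 - 1 / (n : ℝ)) * Real.logb 2 (((n : ℝ) - 1) / Real.sqrt n) := by
  set A := centeredCube n ((n : ℝ) ^ (-(1 : ℝ) / n))
  have hAm : MeasurableSet A := measurableSet_centeredCube n _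
  have hμA : (uniformCube n).real A = 1 / (n : ℝ) :=
    measureReal_uniformCube_centeredCube (by omega)
  have hint : ∀ x, Real.logb 2 (qDensity n x)⁻¹ =
      A.indicator (fun _ => Real.logb 2 (1 / ((n : ℝ) - Real.sqrt n))) x +
        Aᶜ.indicator (fun _ => Real.logb 2 (((n : ℝ) - 1) / Real.sqrt n)) x := by
    intro x
    by_cases hx : x ∈ A
    · have hx' : ∀ i, |x i| ≤ (n : ℝ) ^ (-(1 : ℝ) / n) := hx
      simp [hx, qDensity, if_pos hx']
    · have hx' : ¬ ∀ i, |x i| ≤ (n : ℝ) ^ (-(1 : ℝ) / n) := hx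
      simp only [qDensity, if_neg hx']
      simp [hx]
  have hcongr : relEntropyBits (uniformCube n) (qCube n) =
      ∫ x, Real.logb 2 (qDensity n x)⁻¹ ∂uniformCube n :=
    integral_congr_ae <| (rnDeriv_uniformCube_qCube hn).mono fun x hx => by simp only [hx]
  rw [hcongr]
  simp_rw [hint]
  rw [integral_add ((integrable_const _).indicator hAm)
      ((integrable_const _).indicator hAm.compl),
    integral_indicator_const _ hAm, integral_indicator_const _ hAm.compl,
    probReal_compl_eq_one_sub hAm, hμA, smul_eq_mul, smul_eq_mul]

theorem tendsto_relEntropyBits_div_logb_sqrt :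
    Tendsto (fun n : ℕ =>
        relEntropyBits (uniformCube n) (qCube n) / Real.logb 2 (Real.sqrt n))
      atTop (nhds 1) := by
  have hinv : Tendsto (fun n : ℕ => (n : ℝ)⁻¹) atTop (nhds 0) :=
    tendsto_inv_atTop_zero.comp tendsto_natCast_atTop_atTop
  have hsqrt : Tendsto (fun n : ℕ => (Real.sqrt n)⁻¹) atTop (nhds 0) :=
    tendsto_inv_atTop_zero.comp (Real.tendsto_sqrt_atTop.comp tendsto_natCast_atTop_atTop)
  have hlog : Tendsto (fun n : ℕ => (Real.log n)⁻¹) atTop (nhds 0) :=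
    tendsto_inv_atTop_zero.comp (Real.tendsto_log_atTop.comp tendsto_natCast_atTop_atTop)
  have hlog_one_sub : ∀ {u : ℕ → ℝ}, Tendsto u atTop (nhds 0) →
      Tendsto (fun n => Real.log (1 - u n)) atTop (nhds 0) := fun hu => by
    simpa using (hu.const_sub 1).log (by norm_num)
  have hlim : Tendsto (fun n : ℕ =>
      -(2 * (n : ℝ)⁻¹) * (1 + Real.log (1 - (Real.sqrt n)⁻¹) * (Real.log n)⁻¹) +
        (1 - (n : ℝ)⁻¹) * (1 + 2 * (Real.log (1 - (n : ℝ)⁻¹) * (Real.log n)⁻¹)))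
      atTop (nhds 1) := by
    have h₁ := ((hlog_one_sub hsqrt).mul hlog).const_add 1
    have h₂ := (((hlog_one_sub hinv).mul hlog).const_mul 2).const_add 1
    simpa using ((hinv.const_mul 2).neg.mul h₁).add ((hinv.const_sub 1).mul h₂)
  refine hlim.congr' ?_
  filter_upwards [eventually_ge_atTop 2] with n hn
  rw [relEntropyBits_uniformCube_qCube hn]
  have hn' : (1 : ℝ) < n := by exact_mod_cast hn
  have hn₀ : (0 : ℝ) < n := by linarith
  have hs₀ : 0 < Real.sqrt n := Real.sqrt_pos.2 hn₀
  have hs₁ : 1 < Real.sqrt n := Real.lt_sqrt_of_sq_lt (by simpa using hn')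
  have hL : 0 < Real.log n := Real.log_pos hn'
  have h2 : 0 < Real.log 2 := Real.log_pos (by norm_num)
  have e₁ : Real.log ((n : ℝ) - Real.sqrt n) =
      Real.log n + Real.log (1 - (Real.sqrt n)⁻¹) := by
    rw [← Real.log_mul hn₀.ne' (sub_pos.2 (inv_lt_one_of_one_lt₀ hs₁)).ne', mul_sub, mul_one,
      ← div_eq_mul_inv, Real.div_sqrt]
  have e₂ : Real.log ((n : ℝ) - 1) = Real.log n + Real.log (1 - (n : ℝ)⁻¹) := by
    rw [← Real.log_mul hn₀.ne' (sub_pos.2 (inv_lt_one_of_one_lt₀ hn')).ne', mul_sub, mul_one,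
      mul_inv_cancel₀ hn₀.ne']
  simp only [Real.logb]
  rw [one_div ((n : ℝ) - _), Real.log_inv, Real.log_div (sub_pos.2 hn').ne' hs₀.ne', e₁, e₂,
    Real.log_sqrt hn₀.le]
  field_simp
  ring

theorem tendsto_logb_sqrt_atTop :
    Tendsto (fun n : ℕ => Real.logb 2 (Real.sqrt n)) atTop atTop :=
  (Real.tendsto_logb_atTop one_lt_two).comp
    (Real.tendsto_sqrt_atTop.comp tendsto_natCast_atTop_atTop)

theorem tendsto_logb_sqrt_div_self :
    Tendsto (fun n : ℕ => Real.logb 2 (Real.sqrt n) / (n : ℝ)) atTop (nhds 0) := by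
  have h : Tendsto (fun n : ℕ => Real.log n / (n : ℝ)) atTop (nhds 0) :=
    Real.isLittleO_log_id_atTop.tendsto_div_nhds_zero.comp tendsto_natCast_atTop_atTop
  have h' := h.div_const (2 * Real.log 2)
  rw [zero_div] at h'
  refine h'.congr fun n => ?_
  rw [Real.logb, Real.log_sqrt (Nat.cast_nonneg n)]
  ring

/-- **Sublinear growth of relative entropy.** For `n ≥ 3`, with `p⁽ⁿ⁾` uniform on `[0,1]ⁿ`
and `q⁽ⁿ⁾` as above, the relative entropy equals
`(1/n) log₂ (1/(n - √n)) + (1 - 1/n) log₂ ((n-1)/√n)`; consequently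
`D(p⁽ⁿ⁾‖q⁽ⁿ⁾) / log₂ √n → 1`, so `D(p⁽ⁿ⁾‖q⁽ⁿ⁾) → ∞` while `D(p⁽ⁿ⁾‖q⁽ⁿ⁾)/n → 0`. -/
theorem sublinear_relative_entropy_example :
    (∀ n : ℕ, 3 ≤ n →
      relEntropyBits (uniformCube n) (qCube n) =
        (1 / (n : ℝ)) * Real.logb 2 (1 / ((n : ℝ) - Real.sqrt n)) +
          (1 - 1 / (n : ℝ)) * Real.logb 2 (((n : ℝ) - 1) / Real.sqrt n)) ∧
    Tendsto (fun n : ℕ =>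
        relEntropyBits (uniformCube n) (qCube n) / Real.logb 2 (Real.sqrt n))
      atTop (nhds 1) ∧
    Tendsto (fun n : ℕ => relEntropyBits (uniformCube n) (qCube n)) atTop atTop ∧
    Tendsto (fun n : ℕ => relEntropyBits (uniformCube n) (qCube n) / (n : ℝ))
      atTop (nhds 0) := by
  refine ⟨fun n hn => relEntropyBits_uniformCube_qCube (by omega),
    tendsto_relEntropyBits_div_logb_sqrt, ?_, ?_⟩
  · refine (tendsto_relEntropyBits_div_logb_sqrt.pos_mul_atTop one_pos
      tendsto_logb_sqrt_atTop).congr' ?_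
    filter_upwards [tendsto_logb_sqrt_atTop.eventually_gt_atTop 0] with n hn
    exact div_mul_cancel₀ _ hn.ne'
  · have h := tendsto_relEntropyBits_div_logb_sqrt.mul tendsto_logb_sqrt_div_self
    rw [mul_zero] at h
    refine h.congr' ?_
    filter_upwards [tendsto_logb_sqrt_atTop.eventually_gt_atTop 0] with n hn
    exact div_mul_div_cancel₀ hn.ne'
end
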